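/- Let r ≥ 1, let (j₁,…,j_r) ∈ (ℕ^d)^r be injective (pairwise distinct), let n ∈ (ℤ∖{0})^r, and let κ ∈ ℝ^d satisfy κ_{i⋆} = 0 for some i⋆ ∈ {1,…,d}. Then for all γ > 0, the Lebesgue measure of { a ∈ (1,4)^d : |κ·a + Σ_{k=1}^r n_k √(1 + |j_k|⁴_a)| < γ } is ≲_{r,d} γ^{1/(r(r+1))} (⟨j₁⟩⋯⟨j_r⟩)^{12/(r+1)}. -/

import Mathlib

open MeasureTheory
open scoped BigOperators

noncomputable section

namespace BeamPaper

/-- `|j|_a² = Σᵢ aᵢ jᵢ²` for `j ∈ ℕ^d`. -/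
def anormSqN (d : ℕ) (a : Fin d → ℝ) (j : Fin d → ℕ) : ℝ := ∑ i, a i * (j i : ℝ) ^ 2

/-- `⟨j⟩ = √(1+|j|²)` for `j ∈ ℕ^d`. -/
def japN (d : ℕ) (j : Fin d → ℕ) : ℝ := Real.sqrt (1 + ∑ i, ((j i : ℝ)) ^ 2)

/-- The box `(1,4)^d`. -/
def box (d : ℕ) : Set (Fin d → ℝ) := Set.univ.pi fun _ => Set.Ioo (1 : ℝ) 4

/-- The first `N` terms of `x` lie in `E` and are increasing with gaps at least `η`. -/
def IsSeparated (N : ℕ) (η : ℝ) (E : Set ℝ) (x : ℕ → ℝ) : Prop :=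
  (∀ i < N, x i ∈ E) ∧ ∀ i, i + 1 < N → x i + η ≤ x (i + 1)

/-- A set of reals of measure larger than `2Nη` contains `N` points with gaps at least `η`. -/
lemma exists_isSeparated {η : ℝ} (hη : 0 < η) (N : ℕ) (E : Set ℝ) (hE : BddBelow E)
    (hvol : ENNReal.ofReal (N * (2 * η)) < volume E) : ∃ x, IsSeparated N η E x := by
  induction N generalizing E with
  | zero => exact ⟨fun _ => 0, by simp, by simp⟩
  | succ N ih =>
    have hne : E.Nonempty := by
      by_contra h
      simp [Set.not_nonempty_iff_eq_empty.1 h] at hvol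
    obtain ⟨x₀, hx₀, hlt⟩ := Real.lt_sInf_add_pos hne hη
    have hsub : E ⊆ Set.Icc (sInf E) (sInf E + 2 * η) ∪ (E ∩ Set.Ici (x₀ + η)) := by
      intro y hy
      rcases le_or_gt (x₀ + η) y with h | h
      · exact Or.inr ⟨hy, h⟩
      · exact Or.inl ⟨csInf_le hE hy, by linarith⟩
    have h1 : volume E ≤ ENNReal.ofReal (2 * η) + volume (E ∩ Set.Ici (x₀ + η)) := by
      refine (measure_mono hsub).trans ((measure_union_le _ _).trans ?_)
      rw [Real.volume_Icc]
      gcongr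
      linarith
    have h2 : ENNReal.ofReal (N * (2 * η)) < volume (E ∩ Set.Ici (x₀ + η)) := by
      by_contra! h
      refine absurd hvol (not_lt.2 (h1.trans ((add_le_add_right h _).trans ?_)))
      rw [← ENNReal.ofReal_add (by positivity) (by positivity)]
      apply ENNReal.ofReal_le_ofReal
      push_cast
      linarith
    obtain ⟨x, hx, hsep⟩ := ih _ (hE.mono Set.inter_subset_left) h2
    refine ⟨fun i => Nat.casesOn i x₀ x, ?_, ?_⟩
    · rintro (_ | i) hi
      · exact hx₀
      · exact (hx i (by omega)).1
    · rintro (_ | i) hi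
      · exact (hx 0 (by omega)).2
      · exact hsep i (by omega)

/-- Mean value theorem on alternate gaps: a function that is small at `2N` separated points has
small derivative at `N` separated points. -/
lemma IsSeparated.exists_deriv_le {F G : ℝ → ℝ} {N : ℕ} {η ε p q : ℝ} {x : ℕ → ℝ} (hη : 0 < η)
    (hx : IsSeparated (2 * N) η (Set.Icc p q) x)
    (hF : ∀ u ∈ Set.Icc p q, HasDerivAt F (G u) u) (hε : ∀ i < 2 * N, |F (x i)| ≤ ε) :
    ∃ y, IsSeparated N η (Set.Icc p q) y ∧ ∀ i < N, |G (y i)| ≤ 2 * ε / η := by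
  have key : ∀ i, ∃ y, i < N → y ∈ Set.Ioo (x (2 * i)) (x (2 * i + 1)) ∧ |G y| ≤ 2 * ε / η := by
    intro i
    by_cases hi : i < N
    swap
    · exact ⟨0, fun h => absurd h hi⟩
    have hgap := hx.2 (2 * i) (by omega)
    have ha := hx.1 (2 * i) (by omega)
    have hb := hx.1 (2 * i + 1) (by omega)
    have hsub := Set.Icc_subset_Icc ha.1 hb.2
    obtain ⟨y, hy, hGy⟩ := exists_hasDerivAt_eq_slope F G (show x (2 * i) < x (2 * i + 1) by linarith)
      (fun u hu => (hF u (hsub hu)).continuousAt.continuousWithinAt)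
      (fun u hu => hF u (hsub (Set.Ioo_subset_Icc_self hu)))
    refine ⟨y, fun _ => ⟨hy, ?_⟩⟩
    have h1 := hε (2 * i) (by omega)
    have h2 := hε (2 * i + 1) (by omega)
    have h3 := abs_sub (F (x (2 * i + 1))) (F (x (2 * i)))
    rw [hGy, abs_div]
    refine div_le_div₀ (by linarith [abs_nonneg (F (x (2 * i)))]) (by linarith) hη ?_
    exact le_trans (by linarith) (le_abs_self _)
  choose y hy using key
  refine ⟨y, ⟨fun i hi => ?_, fun i hi => ?_⟩, fun i hi => (hy i hi).2⟩
  · have := (hy i hi).1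
    exact ⟨(hx.1 _ (by omega)).1.trans this.1.le, this.2.le.trans (hx.1 _ (by omega)).2⟩
  · have h1 := (hy i (by omega)).1.2
    have h2 := (hy (i + 1) hi).1.1
    have h3 := hx.2 (2 * i + 1) (by omega)
    rw [show 2 * i + 1 + 1 = 2 * (i + 1) by ring] at h3
    linarith

lemma hasDerivAt_rpow_mul_rpow {u m ν p : ℝ} (hm : 0 < u + m) (hν : 0 < u + ν) (c : ℝ) :
    HasDerivAt (fun u => (u + m) ^ p * (c * (u + ν) ^ (-p)))
      (p * (u + m) ^ (p - 1) * (c * (ν - m) * (u + ν) ^ (-(p + 1)))) u := by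
  have h1 : HasDerivAt (fun u => (u + m) ^ p) (1 * p * (u + m) ^ (p - 1)) u :=
    ((hasDerivAt_id u).add_const m).rpow_const (Or.inl hm.ne')
  have h2 : HasDerivAt (fun u => (u + ν) ^ (-p)) (1 * -p * (u + ν) ^ (-p - 1)) u :=
    ((hasDerivAt_id u).add_const ν).rpow_const (Or.inl hν.ne')
  refine (h1.mul (h2.const_mul c)).congr_deriv ?_
  have e1 : (u + m) ^ p = (u + m) ^ (p - 1) * (u + m) := by
    rw [← Real.rpow_add_one hm.ne']; ring_nf
  have e2 : (u + ν) ^ (-p) = (u + ν) ^ (-(p + 1)) * (u + ν) := by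
    rw [← Real.rpow_add_one hν.ne']; ring_nf
  rw [e1, e2, show -p - 1 = -(p + 1) by ring]
  ring

/-- If a combination of the functions `u ↦ (u + μ) ^ (-p)` is small at sufficiently many separated
points of `[1, 4]`, then each of its coefficients is small. The functions `μ k`, `k ∈ s`, are
eliminated one by one by multiplying with `(u + μ k) ^ p` and differentiating. -/
lemma abs_coeff_mul_prod_le {ι : Type*} [DecidableEq ι] {η R : ℝ} (hη : 0 < η) (μ : ι → ℝ)
    (hμ : ∀ k, 0 ≤ μ k) {μ₀ : ℝ} (hμ₀ : 0 ≤ μ₀) (s : Finset ι) :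
    ∀ (p c₀ ε : ℝ) (c : ι → ℝ) (x : ℕ → ℝ), 1 / 2 ≤ p → p + s.card ≤ R →
      IsSeparated (2 ^ s.card) η (Set.Icc 1 4) x →
      (∀ i < 2 ^ s.card,
        |c₀ * (x i + μ₀) ^ (-p) + ∑ k ∈ s, c k * (x i + μ k) ^ (-p)| ≤ ε) →
      |c₀| * (∏ k ∈ s, |μ₀ - μ k|) * η ^ s.card
        ≤ 4 ^ s.card * ε * (∏ k ∈ s, (4 + μ k) ^ R) * (4 + μ₀) ^ R := by
  induction s using Finset.induction_on with
  | empty =>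
    intro p c₀ ε c x hp hR hx hb
    have h0 := hb 0 (by simp)
    have hx0 := hx.1 0 (by simp)
    simp only [Finset.card_empty, Nat.cast_zero, add_zero, Finset.sum_empty] at hR h0
    have hpos : 0 < x 0 + μ₀ := by linarith [hx0.1]
    rw [abs_mul, abs_of_pos (Real.rpow_pos_of_pos hpos _), Real.rpow_neg hpos.le,
      ← div_eq_mul_inv, div_le_iff₀ (Real.rpow_pos_of_pos hpos _)] at h0
    have hε : 0 ≤ ε := by
      by_contra! h
      have := mul_neg_of_neg_of_pos h (Real.rpow_pos_of_pos hpos p)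
      linarith [abs_nonneg c₀]
    simp only [Finset.card_empty, Finset.prod_empty, pow_zero, mul_one, one_mul]
    refine h0.trans (mul_le_mul_of_nonneg_left ?_ hε)
    calc (x 0 + μ₀) ^ p ≤ (4 + μ₀) ^ p :=
          Real.rpow_le_rpow hpos.le (by linarith [hx0.2]) (by linarith)
      _ ≤ (4 + μ₀) ^ R := Real.rpow_le_rpow_of_exponent_le (by linarith) hR
  | insert l s hl ih =>
    intro p c₀ ε c x hp hR hx hb
    rw [Finset.card_insert_of_notMem hl] at hR hx hb ⊢
    push_cast at hR
    rw [pow_succ'] at hx hb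
    have hε : 0 ≤ ε := (abs_nonneg _).trans (hb 0 (by positivity))
    have hl0 := hμ l
    set A : ℝ := (4 + μ l) with hA
    have hderiv : ∀ u ∈ Set.Icc (1 : ℝ) 4, HasDerivAt
        (fun u => (u + μ l) ^ p *
          (c₀ * (u + μ₀) ^ (-p) + ∑ k ∈ insert l s, c k * (u + μ k) ^ (-p)))
        (p * (u + μ l) ^ (p - 1) * (c₀ * (μ₀ - μ l) * (u + μ₀) ^ (-(p + 1)) +
          ∑ k ∈ s, c k * (μ k - μ l) * (u + μ k) ^ (-(p + 1)))) u := by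
      intro u hu
      have hlu : 0 < u + μ l := by linarith [hu.1]
      have h := (hasDerivAt_rpow_mul_rpow (p := p) hlu (show 0 < u + μ₀ by linarith [hu.1]) c₀).add
        (HasDerivAt.fun_sum (u := insert l s) fun k _ => hasDerivAt_rpow_mul_rpow (p := p) hlu
          (show 0 < u + μ k by linarith [hu.1, hμ k]) (c k))
      refine (h.congr_deriv ?_).congr_of_eventuallyEq (Filter.Eventually.of_forall fun v => ?_)
      · rw [Finset.sum_insert hl]
        simp only [sub_self, mul_zero, zero_mul, zero_add]
        rw [mul_add, Finset.mul_sum]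
      · simp only [Pi.add_apply, mul_add, Finset.mul_sum]
    obtain ⟨y, hy, hyb⟩ := hx.exists_deriv_le (ε := A ^ p * ε) hη hderiv (by
      intro i hi
      have hxi := hx.1 i hi
      have hlu : 0 < x i + μ l := by linarith [hxi.1]
      rw [abs_mul, abs_of_pos (Real.rpow_pos_of_pos hlu _)]
      exact mul_le_mul (Real.rpow_le_rpow hlu.le (by linarith [hxi.2]) (by linarith)) (hb i hi)
        (abs_nonneg _) (Real.rpow_nonneg (by linarith) _))
    have hA1 : 1 ≤ A := by linarith
    have hbound : ∀ i < 2 ^ s.card, |c₀ * (μ₀ - μ l) * (y i + μ₀) ^ (-(p + 1)) +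
        ∑ k ∈ s, c k * (μ k - μ l) * (y i + μ k) ^ (-(p + 1))| ≤ 4 * A ^ R * ε / η := by
      intro i hi
      have hyi := hy.1 i hi
      have hlu : 1 ≤ y i + μ l := by linarith [hyi.1]
      have h := hyb i hi
      have hwpos : 0 < (y i + μ l) ^ (p - 1) := Real.rpow_pos_of_pos (by linarith) _
      rw [abs_mul, abs_of_pos (by positivity)] at h
      set T := |c₀ * (μ₀ - μ l) * (y i + μ₀) ^ (-(p + 1)) +
        ∑ k ∈ s, c k * (μ k - μ l) * (y i + μ k) ^ (-(p + 1))|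
      have hw : 1 ≤ A * (y i + μ l) ^ (p - 1) := by
        calc (1 : ℝ) ≤ (y i + μ l) ^ p := Real.one_le_rpow hlu (by linarith)
          _ = (y i + μ l) * (y i + μ l) ^ (p - 1) := by
            rw [mul_comm, ← Real.rpow_add_one (by linarith)]; ring_nf
          _ ≤ A * (y i + μ l) ^ (p - 1) := by
            gcongr
            linarith [hyi.2]
      have hpw : 1 / 2 ≤ A * (p * (y i + μ l) ^ (p - 1)) := by nlinarith
      have hT : 0 ≤ T := abs_nonneg _
      calc T ≤ 2 * (A * (p * (y i + μ l) ^ (p - 1))) * T := by nlinarith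
        _ = 2 * A * (p * (y i + μ l) ^ (p - 1) * T) := by ring
        _ ≤ 2 * A * (2 * (A ^ p * ε) / η) := by gcongr
        _ = 4 * (A ^ (p + 1)) * ε / η := by
          rw [Real.rpow_add_one (by linarith)]; ring
        _ ≤ 4 * A ^ R * ε / η := by
          gcongr
          linarith [(Nat.cast_nonneg s.card : (0 : ℝ) ≤ _)]
    have h := ih (p + 1) (c₀ * (μ₀ - μ l)) (4 * A ^ R * ε / η) (fun k => c k * (μ k - μ l)) y
      (by linarith) (by linarith) hy hbound
    rw [Finset.prod_insert hl, Finset.prod_insert hl]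
    rw [abs_mul] at h
    calc |c₀| * (|μ₀ - μ l| * ∏ k ∈ s, |μ₀ - μ k|) * η ^ (s.card + 1)
        = (|c₀| * |μ₀ - μ l| * (∏ k ∈ s, |μ₀ - μ k|) * η ^ s.card) * η := by ring
      _ ≤ (4 ^ s.card * (4 * A ^ R * ε / η) * (∏ k ∈ s, (4 + μ k) ^ R) * (4 + μ₀) ^ R) * η := by
        gcongr
      _ = _ := by
        field_simp
        ring

/-- Lower bound on the sup norm of `κ + ∑ n k √(u + μ k)` over separated points. -/
lemma pow_mul_prod_le_of_isSeparated {r : ℕ} {η ε κ : ℝ} (hη : 0 < η) (μ : Fin r → ℝ)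
    (hμ : ∀ k, 0 ≤ μ k) (n : Fin r → ℤ) (k₀ : Fin r) (hn : n k₀ ≠ 0) (x : ℕ → ℝ)
    (hx : IsSeparated (2 ^ r) η (Set.Icc 1 4) x)
    (hb : ∀ i < 2 ^ r, |κ + ∑ k, (n k : ℝ) * √(x i + μ k)| ≤ ε) :
    η ^ r * ∏ k ∈ Finset.univ.erase k₀, |μ k₀ - μ k| ≤ 4 ^ r * ε * (∏ k, (4 + μ k)) ^ r := by
  have hr : r - 1 + 1 = r := Nat.sub_add_cancel k₀.pos
  have hcard : (Finset.univ.erase k₀).card = r - 1 := by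
    rw [Finset.card_erase_of_mem (Finset.mem_univ _), Finset.card_univ, Fintype.card_fin]
  have hε : 0 ≤ ε := (abs_nonneg _).trans (hb 0 (by positivity))
  have hpow : 2 ^ r = 2 * 2 ^ (r - 1) := by rw [← pow_succ', hr]
  rw [hpow] at hx hb
  have hderiv : ∀ u ∈ Set.Icc (1 : ℝ) 4, HasDerivAt
      (fun u => κ + ∑ k, (n k : ℝ) * √(u + μ k))
      (∑ k, (n k : ℝ) / 2 * (u + μ k) ^ (-(1 / 2) : ℝ)) u := by
    intro u hu
    refine (HasDerivAt.fun_sum (u := Finset.univ) fun k _ => ?_).const_add κ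
    have hpos : 0 < u + μ k := by linarith [hu.1, hμ k]
    refine ((((hasDerivAt_id u).add_const (μ k)).sqrt hpos.ne').const_mul (n k : ℝ)).congr_deriv ?_
    rw [Real.rpow_neg hpos.le, ← Real.sqrt_eq_rpow]
    simp only [id]
    field_simp
  obtain ⟨y, hy, hyb⟩ := hx.exists_deriv_le hη hderiv hb
  rw [← hcard] at hy hyb
  have h := abs_coeff_mul_prod_le (R := r) hη μ hμ (hμ k₀) (Finset.univ.erase k₀) (1 / 2)
    ((n k₀ : ℝ) / 2) (2 * ε / η) (fun k => (n k : ℝ) / 2) y le_rfl (by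
      rw [hcard]
      have : ((r - 1 : ℕ) : ℝ) + 1 = r := by exact_mod_cast hr
      linarith) hy (by
      intro i hi
      have := hyb i hi
      rwa [← Finset.add_sum_erase _ _ (Finset.mem_univ k₀)] at this)
  simp only [Real.rpow_natCast] at h
  rw [mul_assoc (4 ^ _ * _), Finset.prod_pow,
    ← mul_pow, Finset.prod_erase_mul _ _ (Finset.mem_univ k₀), hcard] at h
  have hn1 : (1 : ℝ) / 2 ≤ |(n k₀ : ℝ) / 2| := by
    rw [abs_div, abs_two]
    have : (1 : ℝ) ≤ |(n k₀ : ℝ)| := by exact_mod_cast Int.one_le_abs hn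
    linarith
  set Q := ∏ k ∈ Finset.univ.erase k₀, |μ k₀ - μ k|
  have hQ : 0 ≤ Q := Finset.prod_nonneg fun _ _ => abs_nonneg _
  calc η ^ r * Q = 2 * η * (1 / 2 * Q * η ^ (r - 1)) := by
        nth_rw 1 [← hr]
        ring
    _ ≤ 2 * η * (|(n k₀ : ℝ) / 2| * Q * η ^ (r - 1)) := by gcongr
    _ ≤ 2 * η * (4 ^ (r - 1) * (2 * ε / η) * (∏ k, (4 + μ k)) ^ r) := by
      gcongr
    _ = 4 ^ (r - 1 + 1) * ε * (∏ k, (4 + μ k)) ^ r := by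
      field_simp
      ring
    _ = _ := by rw [hr]

/-- Averaging bound: if every map `φ u`, `u ∈ [p, q]`, does not decrease the measure of `A` under
preimages, these preimages stay inside `K`, and each `a` lies in the preimages only for a set of
parameters `u` of measure at most `M`, then `A` has measure at most `M * volume K`. -/
lemma volume_le_mul_of_preimage {E : Type*} [MeasureSpace E] [SFinite (volume : Measure E)]
    {A K : Set E} (hA : MeasurableSet A) (hK : MeasurableSet K) {p q : ℝ} (hpq : 1 ≤ q - p)
    (φ : ℝ → E → E)
    (hφ : Measurable (Function.uncurry φ)) (M : ENNReal)
    (hvol : ∀ u ∈ Set.Icc p q, volume A ≤ volume (φ u ⁻¹' A))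
    (hsub : ∀ u ∈ Set.Icc p q, φ u ⁻¹' A ⊆ K)
    (hM : ∀ a ∈ K, volume {u | u ∈ Set.Icc p q ∧ φ u a ∈ A} ≤ M) :
    volume A ≤ M * volume K := by
  set S : Set (ℝ × E) := {z | z.1 ∈ Set.Icc p q ∧ φ z.1 z.2 ∈ A}
  have hS : MeasurableSet S := (measurable_fst measurableSet_Icc).inter (hφ hA)
  have hle : volume A ≤ (volume.prod volume) S := by
    rw [Measure.prod_apply hS]
    calc volume A = 1 * volume A := (one_mul _).symm
      _ ≤ volume (Set.Icc p q) * volume A := by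
        gcongr
        rw [Real.volume_Icc]
        exact ENNReal.one_le_ofReal.2 hpq
      _ = ∫⁻ _ in Set.Icc p q, volume A := by rw [setLIntegral_const, mul_comm]
      _ ≤ ∫⁻ u in Set.Icc p q, volume (Prod.mk u ⁻¹' S) := by
        refine setLIntegral_mono' measurableSet_Icc fun u hu => (hvol u hu).trans ?_
        exact measure_mono fun a ha => ⟨hu, ha⟩
      _ ≤ _ := setLIntegral_le_lintegral _ _
  refine hle.trans ?_
  rw [Measure.prod_apply_symm hS, ← setLIntegral_const]
  have hsupp : (fun a => volume ((fun u => (u, a)) ⁻¹' S)) ≤ K.indicator fun _ => M := by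
    intro a
    by_cases ha : a ∈ K
    · rw [Set.indicator_of_mem ha]
      exact hM a ha
    · rw [Set.indicator_of_notMem ha]
      have : (fun u => (u, a)) ⁻¹' S = ∅ := by
        ext u
        simp only [Set.mem_preimage, Set.mem_empty_iff_false, iff_false]
        exact fun h => ha (hsub u h.1 h.2)
      simp [this]
  refine (lintegral_mono hsupp).trans ?_
  rw [lintegral_indicator hK]

lemma measurableSet_box (d : ℕ) : MeasurableSet (box d) :=
  MeasurableSet.univ_pi fun _ => measurableSet_Ioo

lemma continuous_anormSqN (d : ℕ) (j : Fin d → ℕ) : Continuous fun a => anormSqN d a j := by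
  unfold anormSqN
  fun_prop

lemma volume_Icc_zero_eight (d : ℕ) :
    volume (Set.Icc (fun _ => 0 : Fin d → ℝ) fun _ => 8) = ENNReal.ofReal (8 ^ d) := by
  rw [Real.volume_Icc_pi]
  simp [ENNReal.ofReal_pow]

lemma box_subset_Icc (d : ℕ) : box d ⊆ Set.Icc (fun _ => 0) fun _ => 8 := fun a ha =>
  ⟨fun i => by linarith [(ha i trivial).1], fun i => by linarith [(ha i trivial).2]⟩

lemma anormSqN_add_single (d : ℕ) (a : Fin d → ℝ) (i : Fin d) (t : ℝ) (j : Fin d → ℕ) :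
    anormSqN d (a + Pi.single i t) j = anormSqN d a j + t * (j i : ℝ) ^ 2 := by
  simp only [anormSqN, Pi.add_apply, add_mul, Finset.sum_add_distrib]
  congr 1
  rw [Finset.sum_eq_single i] <;> simp +contextual

lemma anormSqN_smul (d : ℕ) (a : Fin d → ℝ) (t : ℝ) (j : Fin d → ℕ) :
    anormSqN d (t • a) j = t * anormSqN d a j := by
  simp [anormSqN, Finset.mul_sum, mul_assoc]

lemma anormSqN_nonneg {d : ℕ} {a : Fin d → ℝ} (ha : ∀ i, 0 ≤ a i) (j : Fin d → ℕ) :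
    0 ≤ anormSqN d a j :=
  Finset.sum_nonneg fun i _ => mul_nonneg (ha i) (sq_nonneg _)

lemma anormSqN_le {d : ℕ} {a : Fin d → ℝ} (ha : ∀ i, a i ≤ 8) (j : Fin d → ℕ) :
    anormSqN d a j ≤ 8 * japN d j ^ 2 := by
  have h : anormSqN d a j ≤ 8 * ∑ i, (j i : ℝ) ^ 2 := by
    rw [Finset.mul_sum]
    exact Finset.sum_le_sum fun i _ => mul_le_mul_of_nonneg_right (ha i) (sq_nonneg _)
  rw [japN, Real.sq_sqrt (by positivity)]
  linarith

lemma one_le_japN (d : ℕ) (j : Fin d → ℕ) : 1 ≤ japN d j := by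
  rw [japN, Real.one_le_sqrt]
  linarith [Finset.sum_nonneg fun i (_ : i ∈ Finset.univ) => sq_nonneg (j i : ℝ)]

/-- Distinct lattice points have close `a`-norms only for a small set of `a`. -/
lemma volume_abs_anormSqN_sub_lt_le {d : ℕ} {j j' : Fin d → ℕ} (hj : j ≠ j') {δ : ℝ} :
    volume {a | a ∈ box d ∧ |anormSqN d a j - anormSqN d a j'| < δ}
      ≤ ENNReal.ofReal (2 * δ) * ENNReal.ofReal (8 ^ d) := by
  obtain ⟨i, hi⟩ := Function.ne_iff.1 hj
  set v : ℝ := (j i : ℝ) ^ 2 - (j' i : ℝ) ^ 2 with hv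
  have hv1 : 1 ≤ |v| := by
    have hne : (j i : ℤ) ^ 2 - (j' i : ℤ) ^ 2 ≠ 0 := by
      rw [sub_ne_zero, Ne, sq_eq_sq₀ (by positivity) (by positivity)]
      exact_mod_cast hi
    have := Int.one_le_abs hne
    rw [hv]
    exact_mod_cast this
  have hmeas : MeasurableSet {a | a ∈ box d ∧ |anormSqN d a j - anormSqN d a j'| < δ} :=
    (measurableSet_box d).inter (measurableSet_lt
      ((continuous_anormSqN d j).sub (continuous_anormSqN d j')).abs.measurable measurable_const)
  rw [← volume_Icc_zero_eight]
  refine volume_le_mul_of_preimage hmeas measurableSet_Icc (p := 0) (q := 1) (by norm_num)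
    (fun t a => a + Pi.single i t) ?_ _ ?_ ?_ ?_
  · have : Continuous fun z : ℝ × (Fin d → ℝ) => z.2 + Pi.single i z.1 :=
      continuous_snd.add ((continuous_single i).comp continuous_fst)
    exact this.measurable
  · intro t _
    rw [measure_preimage_add_right]
  · intro t ht a ha
    have hbox : ∀ k, a k + (Pi.single i t : Fin d → ℝ) k ∈ Set.Ioo (1 : ℝ) 4 :=
      fun k => ha.1 k trivial
    have hs : ∀ k, (Pi.single i t : Fin d → ℝ) k ∈ Set.Icc (0 : ℝ) 1 := by
      intro k
      by_cases hk : k = i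
      · subst hk; simpa using ht
      · simp [hk]
    exact ⟨fun k => by linarith [(hbox k).1, (hs k).2], fun k => by linarith [(hbox k).2, (hs k).1]⟩
  · intro a _
    set c := anormSqN d a j - anormSqN d a j'
    have hsub : {t | t ∈ Set.Icc (0 : ℝ) 1 ∧ a + Pi.single i t ∈
        {a | a ∈ box d ∧ |anormSqN d a j - anormSqN d a j'| < δ}} ⊆
        Metric.closedBall (-c / v) δ := by
      rintro t ⟨-, -, ht⟩
      rw [anormSqN_add_single, anormSqN_add_single] at ht
      have hv0 : v ≠ 0 := by
        rintro h
        simp [h] at hv1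
        linarith
      rw [Metric.mem_closedBall, Real.dist_eq]
      have e : anormSqN d a j + t * (j i : ℝ) ^ 2 - (anormSqN d a j' + t * (j' i : ℝ) ^ 2)
          = v * (t - -c / v) := by
        field_simp
        ring
      rw [e, abs_mul] at ht
      nlinarith [abs_nonneg (t - -c / v)]
    exact (measure_mono hsub).trans (Real.volume_closedBall _ _).le

lemma volume_le_volume_preimage_smul {d : ℕ} {u : ℝ} (hu : 1 ≤ u) (A : Set (Fin d → ℝ)) :
    volume A ≤ volume ((fun a => (√u)⁻¹ • a) ⁻¹' A) := by
  have hs : 1 ≤ √u := Real.one_le_sqrt.2 hu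
  rw [Measure.addHaar_preimage_smul _ (by positivity)]
  refine le_mul_of_one_le_left zero_le ?_
  rw [ENNReal.one_le_ofReal, inv_pow, inv_inv]
  exact (one_le_pow₀ hs).trans (le_abs_self _)

/-- The part of the sublevel set where the `a`-norms of the `j k` are `θ`-separated. -/
lemma volume_separated_sublevel_le {d r : ℕ} (hr : 1 ≤ r) (j : Fin r → Fin d → ℕ) (n : Fin r → ℤ)
    (hn : ∀ k, n k ≠ 0) (κ : Fin d → ℝ) {γ θ : ℝ} (hγ : 0 < γ) (hθ : 0 < θ) (hθ1 : θ ≤ 1)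
    (hγθ : γ * (∏ k, japN d (j k)) ^ (4 * r) ≤ θ ^ (r * (r + 1))) :
    volume {a | a ∈ box d ∧ |(∑ i, κ i * a i) + ∑ k, (n k : ℝ) *
        √(1 + anormSqN d a (j k) ^ 2)| < γ ∧
        ∀ k l, k ≠ l → θ ≤ |anormSqN d a (j k) - anormSqN d a (j l)|}
      ≤ ENNReal.ofReal (2 ^ r * (2 * (32 * 68 ^ r * θ))) * ENNReal.ofReal (8 ^ d) := by
  set A := {a | a ∈ box d ∧ |(∑ i, κ i * a i) + ∑ k, (n k : ℝ) *
        √(1 + anormSqN d a (j k) ^ 2)| < γ ∧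
        ∀ k l, k ≠ l → θ ≤ |anormSqN d a (j k) - anormSqN d a (j l)|}
  have hc := continuous_anormSqN d
  have hA : MeasurableSet A := by
    have e : A = box d ∩ ({a | |(∑ i, κ i * a i) + ∑ k, (n k : ℝ) *
        √(1 + anormSqN d a (j k) ^ 2)| < γ} ∩
        ⋂ k, ⋂ l, ⋂ (_ : k ≠ l), {a | θ ≤ |anormSqN d a (j k) - anormSqN d a (j l)|}) := by
      ext
      simp only [A, Set.mem_inter_iff, Set.mem_iInter, Set.mem_ofPred_eq]
    rw [e]
    refine (measurableSet_box d).inter (MeasurableSet.inter (measurableSet_lt ?_ measurable_const) ?_)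
    · refine Continuous.measurable (Continuous.abs (Continuous.add (by fun_prop) ?_))
      exact continuous_finsetSum _ fun k _ =>
        continuous_const.mul (continuous_const.add ((hc (j k)).pow 2)).sqrt
    · exact MeasurableSet.iInter fun k => MeasurableSet.iInter fun l => MeasurableSet.iInter fun _ =>
        measurableSet_le measurable_const ((hc (j k)).sub (hc (j l))).abs.measurable
  have hmem : ∀ u ∈ Set.Icc (1 : ℝ) 4, ∀ a, (√u)⁻¹ • a ∈ A → ∀ i, 0 ≤ a i ∧ a i ≤ 8 := by
    intro u hu a ha i
    have hs1 : 1 ≤ √u := Real.one_le_sqrt.2 hu.1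
    have hs2 : √u ≤ 2 := by
      rw [Real.sqrt_le_left (by norm_num)]
      linarith [hu.2]
    obtain ⟨h1, h2⟩ := ha.1 i trivial
    simp only [Pi.smul_apply, smul_eq_mul] at h1 h2
    rw [← div_eq_inv_mul] at h1 h2
    rw [lt_div_iff₀ (by linarith)] at h1
    rw [div_lt_iff₀ (by linarith)] at h2
    constructor <;> linarith
  rw [← volume_Icc_zero_eight]
  refine volume_le_mul_of_preimage hA measurableSet_Icc (p := 1) (q := 4) (by norm_num)
    (fun u a => (√u)⁻¹ • a) ?_ _ (fun u hu => volume_le_volume_preimage_smul hu.1 A)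
    (fun u hu a ha => ⟨fun i => (hmem u hu a ha i).1, fun i => (hmem u hu a ha i).2⟩) ?_
  · exact (Real.continuous_sqrt.measurable.comp measurable_fst).inv.smul measurable_snd
  rintro a ⟨ha0, ha8⟩
  by_contra! hlt
  set η := 32 * 68 ^ r * θ with hη
  have hηpos : 0 < η := by positivity
  obtain ⟨x, hx⟩ := exists_isSeparated hηpos (2 ^ r) _ ⟨1, fun u (hu : u ∈ Set.Icc 1 4 ∧ _) => hu.1.1⟩
    (by push_cast; exact hlt)
  set μ : Fin r → ℝ := fun k => anormSqN d a (j k) ^ 2 with hμdef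
  have hlam : ∀ k, 0 ≤ anormSqN d a (j k) := fun k => anormSqN_nonneg ha0 _
  set P := ∏ k, japN d (j k) with hP
  have hbound : ∀ i < 2 ^ r, |(∑ i, κ i * a i) + ∑ k, (n k : ℝ) * √(x i + μ k)| ≤ 2 * γ := by
    intro i hi
    obtain ⟨hxi, -, hlt, -⟩ := hx.1 i hi
    have hs1 : 1 ≤ √(x i) := Real.one_le_sqrt.2 hxi.1
    have hs2 : √(x i) ≤ 2 := by
      rw [Real.sqrt_le_left (by norm_num)]
      linarith [hxi.2]
    have hsq : √(x i) ^ 2 = x i := Real.sq_sqrt (by linarith [hxi.1])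
    have e : (∑ k, κ k * a k) + ∑ k, (n k : ℝ) * √(x i + μ k) =
        √(x i) * ((∑ k, κ k * ((√(x i))⁻¹ • a) k) + ∑ k, (n k : ℝ) *
        √(1 + anormSqN d ((√(x i))⁻¹ • a) (j k) ^ 2)) := by
      rw [mul_add, Finset.mul_sum, Finset.mul_sum]
      congr 1
      · refine Finset.sum_congr rfl fun k _ => ?_
        simp only [Pi.smul_apply, smul_eq_mul]
        field_simp
      · refine Finset.sum_congr rfl fun k _ => ?_
        rw [anormSqN_smul, mul_left_comm, ← Real.sqrt_mul (by linarith [hxi.1])]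
        congr 2
        rw [mul_pow, inv_pow, hsq]
        have : x i ≠ 0 := by linarith [hxi.1]
        field_simp
        rfl
    rw [e, abs_mul, abs_of_pos (by linarith)]
    exact mul_le_mul hs2 hlt.le (abs_nonneg _) (by norm_num)
  have hmain := pow_mul_prod_le_of_isSeparated hηpos μ (fun k => sq_nonneg _) n ⟨0, hr⟩ (hn _) x
    ⟨fun i hi => (hx.1 i hi).1, hx.2⟩ hbound
  have hlow : θ ^ (2 * (r - 1)) ≤ ∏ k ∈ Finset.univ.erase ⟨0, hr⟩, |μ ⟨0, hr⟩ - μ k| := by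
    have hcard : (Finset.univ.erase (⟨0, hr⟩ : Fin r)).card = r - 1 := by
      rw [Finset.card_erase_of_mem (Finset.mem_univ _), Finset.card_univ, Fintype.card_fin]
    rw [pow_mul, ← hcard, ← Finset.prod_const]
    refine Finset.prod_le_prod (fun _ _ => by positivity) fun k hk => ?_
    obtain ⟨hxi, -, -, hsep⟩ := hx.1 0 (by positivity)
    have hs1 : 1 ≤ √(x 0) := Real.one_le_sqrt.2 hxi.1
    have h := hsep ⟨0, hr⟩ k (Finset.ne_of_mem_erase hk).symm
    rw [anormSqN_smul, anormSqN_smul, ← mul_sub, abs_mul, abs_inv, abs_of_pos (by linarith),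
      ← div_eq_inv_mul, le_div_iff₀ (by linarith)] at h
    have h0 := hlam ⟨0, hr⟩
    have hk0 := hlam k
    simp only [hμdef]
    rw [sq_sub_sq, abs_mul, abs_of_nonneg (by linarith), sq]
    have h1 : θ ≤ |anormSqN d a (j ⟨0, hr⟩) - anormSqN d a (j k)| := by nlinarith
    refine mul_le_mul (h1.trans ?_) h1 hθ.le (by linarith)
    rw [abs_le]
    constructor <;> linarith
  have hup : (∏ k, (4 + μ k)) ^ r ≤ (68 ^ r) ^ r * P ^ (4 * r) := by
    have h : ∏ k, (4 + μ k) ≤ 68 ^ r * P ^ 4 := by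
      calc ∏ k, (4 + μ k) ≤ ∏ k, (68 * japN d (j k) ^ 4) := by
            refine Finset.prod_le_prod (fun k _ => by positivity) fun k _ => ?_
            have h1 := anormSqN_le ha8 (j k)
            have h2 := one_le_pow₀ (one_le_japN d (j k)) (n := 4)
            have h3 : anormSqN d a (j k) ^ 2 ≤ (8 * japN d (j k) ^ 2) ^ 2 :=
              pow_le_pow_left₀ (hlam k) h1 2
            simp only [hμdef]
            nlinarith
        _ = 68 ^ r * P ^ 4 := by
          rw [Finset.prod_mul_distrib, Finset.prod_pow, Finset.prod_const,
            Finset.card_univ, Fintype.card_fin]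
    calc (∏ k, (4 + μ k)) ^ r ≤ (68 ^ r * P ^ 4) ^ r :=
          pow_le_pow_left₀ (Finset.prod_nonneg fun k _ => by positivity) h r
      _ = _ := by rw [mul_pow, ← pow_mul P]
  have hexp : θ ^ (r * (r + 1)) ≤ θ ^ (r + 2 * (r - 1)) := by
    refine pow_le_pow_of_le_one hθ.le hθ1 ?_
    obtain ⟨s, rfl⟩ := Nat.exists_eq_add_of_le' hr
    simp only [Nat.add_sub_cancel]
    nlinarith
  have h8 : (8 : ℝ) ≤ 8 ^ r := le_self_pow₀ (by norm_num) (by omega)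
  set T := θ ^ (r + 2 * (r - 1))
  have hT : 0 < T := by positivity
  have hfinal : 8 ^ r * 4 ^ r * (68 ^ r) ^ r * T ≤ 2 * 4 ^ r * (68 ^ r) ^ r * T := by
    calc 8 ^ r * 4 ^ r * (68 ^ r) ^ r * T = η ^ r * θ ^ (2 * (r - 1)) := by
          rw [hη, mul_pow, mul_pow, show (32 : ℝ) = 8 * 4 by norm_num, mul_pow, mul_assoc _ (θ ^ r),
            ← pow_add]
      _ ≤ η ^ r * ∏ k ∈ Finset.univ.erase ⟨0, hr⟩, |μ ⟨0, hr⟩ - μ k| := by gcongr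
      _ ≤ 4 ^ r * (2 * γ) * (∏ k, (4 + μ k)) ^ r := hmain
      _ ≤ 4 ^ r * (2 * γ) * ((68 ^ r) ^ r * P ^ (4 * r)) := by gcongr
      _ = 2 * 4 ^ r * (68 ^ r) ^ r * (γ * P ^ (4 * r)) := by ring
      _ ≤ 2 * 4 ^ r * (68 ^ r) ^ r * T := by
        gcongr
        exact hγθ.trans hexp
  have hpos : 0 < 4 ^ r * (68 ^ r) ^ r * T := by positivity
  nlinarith

/-- Lemma 2.3, `lem_gen`: if `(j₁,…,j_r) ∈ (ℕ^d)^r` is injective,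
`n ∈ (ℤ∖{0})^r` and `κ ∈ ℝ^d` has a vanishing coordinate, then for all `γ > 0` the
measure of `{a ∈ (1,4)^d : |κ·a + Σ_k n_k √(1+|j_k|⁴_a)| < γ}` is
`≲_{r,d} γ^{1/(r(r+1))} (⟨j₁⟩⋯⟨j_r⟩)^{12/(r+1)}`. -/
theorem measure_gen (d r : ℕ) (hd : 1 ≤ d) (hr : 1 ≤ r) :
    ∃ C : ℝ, 0 < C ∧
      ∀ (j : Fin r → Fin d → ℕ), Function.Injective j →
      ∀ (n : Fin r → ℤ), (∀ k, n k ≠ 0) →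
      ∀ (κ : Fin d → ℝ) (iS : Fin d), κ iS = 0 →
      ∀ γ : ℝ, 0 < γ →
        volume {a : Fin d → ℝ | a ∈ box d ∧
            |(∑ i, κ i * a i) + ∑ k, (n k : ℝ) *
              Real.sqrt (1 + anormSqN d a (j k) ^ 2)| < γ}
          ≤ ENNReal.ofReal
              (C * γ ^ ((1 : ℝ) / ((r : ℝ) * ((r : ℝ) + 1))) *
                (∏ k, japN d (j k)) ^ ((12 : ℝ) / ((r : ℝ) + 1))) := by
  refine ⟨8 ^ d * (1 + 2 ^ r * (2 * (32 * 68 ^ r)) + r * (r * 2)), by positivity, ?_⟩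
  intro j hj n hn κ iS _ γ hγ
  set P := ∏ k, japN d (j k) with hP
  have hP1 : 1 ≤ P := Finset.prod_induction _ (1 ≤ ·)
    (fun _ _ => one_le_mul_of_one_le_of_one_le) le_rfl fun k _ => one_le_japN d (j k)
  have hr0 : (0 : ℝ) < r := by exact_mod_cast hr
  set θ : ℝ := (γ * P ^ (4 * r)) ^ ((1 : ℝ) / (r * (r + 1))) with hθdef
  have hθ : 0 < θ := by positivity
  have hθpow : θ ^ (r * (r + 1)) = γ * P ^ (4 * r) := by
    rw [hθdef, ← Real.rpow_natCast, ← Real.rpow_mul (by positivity)]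
    push_cast
    rw [one_div_mul_cancel (by positivity), Real.rpow_one]
  have hθle : θ ≤ γ ^ ((1 : ℝ) / (r * (r + 1))) * P ^ ((12 : ℝ) / (r + 1)) := by
    rw [hθdef, Real.mul_rpow hγ.le (by positivity), ← Real.rpow_natCast, ← Real.rpow_mul (by positivity)]
    refine mul_le_mul_of_nonneg_left (Real.rpow_le_rpow_of_exponent_le hP1 ?_) (by positivity)
    push_cast
    rw [show (4 * r : ℝ) * (1 / (r * (r + 1))) = 4 / (r + 1) by field_simp]
    gcongr
    norm_num
  set S := {a : Fin d → ℝ | a ∈ box d ∧ |(∑ i, κ i * a i) + ∑ k, (n k : ℝ) *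
    Real.sqrt (1 + anormSqN d a (j k) ^ 2)| < γ}
  set B : ℝ := 1 + 2 ^ r * (2 * (32 * 68 ^ r)) + r * (r * 2) with hB
  have key : volume S ≤ ENNReal.ofReal (8 ^ d * B * θ) := by
    rcases le_or_gt 1 θ with h1 | h1
    · calc volume S ≤ volume (Set.Icc (fun _ => 0 : Fin d → ℝ) fun _ => 8) :=
            measure_mono fun a ha => box_subset_Icc d ha.1
        _ = ENNReal.ofReal (8 ^ d) := volume_Icc_zero_eight d
        _ ≤ _ := by
          apply ENNReal.ofReal_le_ofReal
          have hB1 : 1 ≤ B := by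
            rw [hB, add_assoc]
            exact le_add_of_nonneg_right (by positivity)
          rw [mul_assoc]
          exact le_mul_of_one_le_right (by positivity) (one_le_mul_of_one_le_of_one_le hB1 h1)
    · have hgood := volume_separated_sublevel_le hr j n hn κ hγ hθ h1.le hθpow.ge
      have hsub : S ⊆ {a | a ∈ box d ∧ |(∑ i, κ i * a i) + ∑ k, (n k : ℝ) *
          √(1 + anormSqN d a (j k) ^ 2)| < γ ∧
          ∀ k l, k ≠ l → θ ≤ |anormSqN d a (j k) - anormSqN d a (j l)|} ∪
          ⋃ k, ⋃ l, {a | k ≠ l ∧ a ∈ box d ∧ |anormSqN d a (j k) - anormSqN d a (j l)| < θ} := by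
        intro a ha
        by_cases h : ∀ k l, k ≠ l → θ ≤ |anormSqN d a (j k) - anormSqN d a (j l)|
        · exact Or.inl ⟨ha.1, ha.2, h⟩
        · push Not at h
          obtain ⟨k, l, hkl, h⟩ := h
          exact Or.inr (Set.mem_iUnion₂.2 ⟨k, l, hkl, ha.1, h⟩)
      have hbad : ∀ k l, volume {a | k ≠ l ∧ a ∈ box d ∧
          |anormSqN d a (j k) - anormSqN d a (j l)| < θ} ≤ ENNReal.ofReal (2 * θ * 8 ^ d) := by
        intro k l
        by_cases hkl : k = l
        · simp [hkl]
        · rw [ENNReal.ofReal_mul (by positivity)]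
          exact (measure_mono fun a ha => ha.2).trans
            (volume_abs_anormSqN_sub_lt_le fun h => hkl (hj h))
      have hbad' : volume (⋃ k, ⋃ l, {a | k ≠ l ∧ a ∈ box d ∧
          |anormSqN d a (j k) - anormSqN d a (j l)| < θ}) ≤
          ENNReal.ofReal (r * (r * (2 * θ * 8 ^ d))) := by
        refine (measure_iUnion_fintype_le _ _).trans ((Finset.sum_le_sum fun k _ =>
          (measure_iUnion_fintype_le _ _).trans (Finset.sum_le_sum fun l _ => hbad k l)).trans ?_)
        simp only [Finset.sum_const, Finset.card_univ, Fintype.card_fin, nsmul_eq_mul]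
        rw [ENNReal.ofReal_mul hr0.le, ENNReal.ofReal_mul hr0.le, ENNReal.ofReal_natCast]
      refine (measure_mono hsub).trans ((measure_union_le _ _).trans
        ((add_le_add hgood hbad').trans ?_))
      rw [← ENNReal.ofReal_mul (by positivity), ← ENNReal.ofReal_add (by positivity) (by positivity)]
      apply ENNReal.ofReal_le_ofReal
      have : 0 < 8 ^ d * θ := by positivity
      rw [hB]
      linarith
  refine key.trans (ENNReal.ofReal_le_ofReal ?_)
  rw [mul_assoc (8 ^ d * B)]
  gcongr

end BeamPaper
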